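/- arXiv:2506.01501 — 3 statements merged into one kernel-verified Lean document; each statement's English description precedes it below -/
import Mathlib

section
/- Let C be a locally finite category in which morphisms admit epi-mono factorization. Then for any pair of objects c, d of C, the cardinality |Hom_C(c,d)| equals the (finitely supported) sum, over all isomorphism classes of quotients c' of c, of the number |Mono_C(c',d)| of monomorphisms from c' to d. -/
open CategoryTheory

universe v u

/-- Morphisms in `C` admit epi-mono factorization: every morphism factors as an epimorphism
followed by a monomorphism, uniquely up to isomorphism. -/
def HasEpiMonoFactorization (C : Type u) [Category.{v} C] : Prop :=
  ∀ ⦃a b : C⦄ (f : a ⟶ b), ∃ (m : C) (p : a ⟶ m) (i : m ⟶ b),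
    Epi p ∧ Mono i ∧ p ≫ i = f ∧
      ∀ (m' : C) (p' : a ⟶ m') (i' : m' ⟶ b), Epi p' → Mono i' → p' ≫ i' = f →
        ∃ δ : m ≅ m', p ≫ δ.hom = p' ∧ δ.hom ≫ i' = i

/-- The cardinality of a finite sigma type is the finitely supported sum of the cardinalities of
its fibres, with no finiteness assumption on the base. -/
theorem Nat.card_sigma_eq_finsum {α : Type*} {β : α → Type*} [Finite (Σ a, β a)] :
    Nat.card (Σ a, β a) = ∑ᶠ a, Nat.card (β a) := by
  classical
  cases nonempty_fintype (Σ a, β a)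
  rw [finsum_eq_sum_of_support_subset (s := Finset.univ.image (Sigma.fst : (Σ a, β a) → α)),
    Nat.card_eq_fintype_card, ← Finset.card_univ,
    Finset.card_eq_sum_card_image (Sigma.fst : (Σ a, β a) → α)]
  · refine Finset.sum_congr rfl fun a _ => ?_
    rw [← Nat.card_congr (Equiv.sigmaSubtype a), Nat.card_eq_fintype_card, Fintype.card_subtype]
  · intro a ha
    obtain ⟨⟨b⟩, _⟩ := Nat.card_ne_zero.mp ha
    simpa using ⟨b⟩

/-- Composing a quotient of `c` with a monomorphism into `d`. -/
noncomputable def CategoryTheory.quotientMonoComp {C : Type u} [Category.{v} C] (c d : C)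
    (x : Σ Q : Subobject (Opposite.op c),
      { f : (Subobject.underlying.obj Q).unop ⟶ d // Mono f }) : c ⟶ d :=
  x.1.arrow.unop ≫ x.2.1

theorem HasEpiMonoFactorization.quotientMonoComp_bijective {C : Type u} [Category.{v} C]
    (hfac : HasEpiMonoFactorization C) (c d : C) :
    Function.Bijective (quotientMonoComp c d) := by
  constructor
  · rintro ⟨Q, f, hf⟩ ⟨R, g, hg⟩ h
    obtain ⟨m, p, i, _, _, _, huniq⟩ := hfac (Q.arrow.unop ≫ f)
    obtain ⟨δ, hδ, _⟩ := huniq _ Q.arrow.unop f inferInstance hf rfl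
    obtain ⟨ε, hε, _⟩ := huniq _ R.arrow.unop g inferInstance hg h.symm
    obtain rfl : Q = R := by
      refine Subobject.eq_of_comm (δ.symm ≪≫ ε).symm.op ?_
      apply Quiver.Hom.unop_inj
      simp [← hδ, ← hε]
    obtain rfl : f = g := (cancel_epi Q.arrow.unop).mp h
    rfl
  · intro f
    obtain ⟨m, p, i, _, _, rfl, _⟩ := hfac f
    refine ⟨⟨Subobject.mk p.op, (Subobject.underlyingIso p.op).inv.unop ≫ i, inferInstance⟩, ?_⟩
    simp only [quotientMonoComp]
    rw [← Category.assoc, ← unop_comp, Subobject.underlyingIso_arrow, Quiver.Hom.unop_op]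

/-- In a locally finite category with epi-mono factorizations, the number of
morphisms `c ⟶ d` is the (finitely supported) sum, over all isomorphism classes of quotients
`c'` of `c` (i.e. subobjects of `c` in the opposite category), of the number of monomorphisms
`c' ⟶ d`. -/
theorem homCount_eq_finsum_monoCount_quotients (C : Type u) [Category.{v} C]
    (hlf : ∀ a b : C, Finite (a ⟶ b)) (hfac : HasEpiMonoFactorization C) (c d : C) :
    Nat.card (c ⟶ d) =
      ∑ᶠ Q : Subobject (Opposite.op c),
        Nat.card { f : (Subobject.underlying.obj Q).unop ⟶ d // Mono f } := by
  have hbij := hfac.quotientMonoComp_bijective c d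
  have := hlf c d
  have := Finite.of_injective _ hbij.injective
  rw [← Nat.card_eq_of_bijective _ hbij, Nat.card_sigma_eq_finsum]
end

section
/- Let C be a category satisfying condition 𝕄 and let a, b be objects of C. The following are equivalent: (i) a ≅ b; (ii) h_a(c) = h_b(c) for every object c of C; (iii) e_a(c) = e_b(c) for every object c of C. -/
open CategoryTheory

universe v u

/-- Condition 𝕄: `C` is locally finite, morphisms admit epi-mono factorization, and for every
object `c` the poset of subobjects of `c`, ordered by `d ≤ d'` iff there is a monomorphism
`d ⟶ d'`, is well-founded (with respect to the associated strict order). -/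
def ConditionM (C : Type u) [Category.{v} C] : Prop :=
  (∀ a b : C, Finite (a ⟶ b)) ∧ HasEpiMonoFactorization C ∧
    ∀ c : C, WellFounded (fun S T : Subobject c =>
      (∃ f : Subobject.underlying.obj S ⟶ Subobject.underlying.obj T, Mono f) ∧
        ¬ ∃ f : Subobject.underlying.obj T ⟶ Subobject.underlying.obj S, Mono f)

/-- Any two epi-mono factorizations of the same morphism are isomorphic. -/
theorem HasEpiMonoFactorization.exists_iso {C : Type u} [Category.{v} C]
    (hF : HasEpiMonoFactorization C) {a c m m' : C} (p : a ⟶ m) (i : m ⟶ c) (p' : a ⟶ m')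
    (i' : m' ⟶ c) [Epi p] [Mono i] [Epi p'] [Mono i'] (h : p ≫ i = p' ≫ i') :
    ∃ δ : m ≅ m', p ≫ δ.hom = p' ∧ δ.hom ≫ i' = i := by
  obtain ⟨n, q, j, -, -, -, hu⟩ := hF (p ≫ i)
  obtain ⟨δ, h₁, h₂⟩ := hu m p i inferInstance inferInstance rfl
  obtain ⟨ε, h₃, h₄⟩ := hu m' p' i' inferInstance inferInstance h.symm
  refine ⟨δ.symm ≪≫ ε, ?_, ?_⟩
  · simp [← h₁, ← h₃]
  · simp [h₄, ← h₂]

/-- In a category with epi-mono factorizations, the non-epimorphisms `a ⟶ c` are exactly the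
epimorphisms from `a` onto the proper subobjects of `c`, followed by the inclusion. -/
theorem HasEpiMonoFactorization.nonempty_sigma_equiv {C : Type u} [Category.{v} C]
    (hF : HasEpiMonoFactorization C) (a c : C) :
    Nonempty ((Σ S : { S : Subobject c // S ≠ ⊤ }, { f : a ⟶ (S.1 : C) // Epi f }) ≃
      { f : a ⟶ c // ¬ Epi f }) := by
  refine ⟨Equiv.ofBijective (fun x => ⟨x.2.1 ≫ x.1.1.arrow, fun hepi => ?_⟩) ⟨?_, ?_⟩⟩
  · obtain ⟨⟨S, hS⟩, p, hp⟩ := x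
    obtain ⟨δ, -, h⟩ := hF.exists_iso p S.arrow (p ≫ S.arrow) (𝟙 c) (by simp)
    refine hS ((Subobject.isIso_iff_mk_eq_top S.arrow).1 ?_ ▸ (Subobject.mk_arrow S).symm)
    rw [← h]
    infer_instance
  · rintro ⟨⟨S, hS⟩, p, hp⟩ ⟨⟨T, hT⟩, q, hq⟩ h
    have h' : p ≫ S.arrow = q ≫ T.arrow := congrArg Subtype.val h
    obtain ⟨δ, -, hδ⟩ := hF.exists_iso p S.arrow q T.arrow h'
    obtain rfl : S = T := Subobject.eq_of_comm δ hδ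
    obtain rfl : p = q := (cancel_mono S.arrow).1 h'
    rfl
  · rintro ⟨f, hf⟩
    obtain ⟨m, p, i, hp, hi, rfl, -⟩ := hF f
    refine ⟨⟨⟨Subobject.mk i, fun htop => hf ?_⟩,
      p ≫ (Subobject.underlyingIso i).inv, inferInstance⟩, ?_⟩
    · have := (Subobject.isIso_iff_mk_eq_top i).2 htop
      infer_instance
    · simp

/-- Epic endomorphisms are invertible when there are only finitely many endomorphisms. -/
theorem isIso_of_epi_endo {C : Type u} [Category.{v} C] {a : C} [Finite (a ⟶ a)] (f : a ⟶ a)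
    [Epi f] : IsIso f := by
  have hinj : Function.Injective (fun g : a ⟶ a => f ≫ g) := fun _ _ h => (cancel_epi f).1 h
  obtain ⟨g, hg : f ≫ g = 𝟙 a⟩ := (Finite.injective_iff_surjective.1 hinj) (𝟙 a)
  have : IsSplitMono f := IsSplitMono.mk' ⟨g, hg⟩
  exact isIso_of_epi_of_isSplitMono f

theorem isIso_of_mono_endo {C : Type u} [Category.{v} C] {a : C} [Finite (a ⟶ a)] (f : a ⟶ a)
    [Mono f] : IsIso f := by
  have hinj : Function.Injective (fun g : a ⟶ a => g ≫ f) := fun _ _ h => (cancel_mono f).1 h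
  obtain ⟨g, hg : g ≫ f = 𝟙 a⟩ := (Finite.injective_iff_surjective.1 hinj) (𝟙 a)
  have : IsSplitEpi f := IsSplitEpi.mk' ⟨g, hg⟩
  exact isIso_of_mono_of_isSplitEpi f

theorem isIso_of_mono_of_mono {C : Type u} [Category.{v} C] {a b : C} [Finite (b ⟶ b)]
    (f : a ⟶ b) (g : b ⟶ a) [Mono f] [Mono g] : IsIso f := by
  have := isIso_of_mono_endo (g ≫ f)
  have : IsSplitEpi f := IsSplitEpi.mk' ⟨inv (g ≫ f) ≫ g, by simp⟩
  exact isIso_of_mono_of_isSplitEpi f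

theorem nonempty_iso_of_epi_of_epi {C : Type u} [Category.{v} C] {a b : C} [Finite (a ⟶ a)]
    (f : a ⟶ b) (g : b ⟶ a) [Epi f] [Epi g] : Nonempty (a ≅ b) := by
  have := isIso_of_epi_endo (f ≫ g)
  have : IsSplitMono f := IsSplitMono.mk' ⟨g ≫ inv (f ≫ g), by
    rw [← Category.assoc, IsIso.hom_inv_id]⟩
  have := isIso_of_epi_of_isSplitMono f
  exact ⟨asIso f⟩

theorem card_epi_congr_right {C : Type u} [Category.{v} C] (a : C) {c d : C} (e : c ≅ d) :
    Nat.card { f : a ⟶ c // Epi f } = Nat.card { f : a ⟶ d // Epi f } :=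
  Nat.card_congr
    { toFun := fun ⟨f, hf⟩ => ⟨f ≫ e.hom, inferInstance⟩
      invFun := fun ⟨f, hf⟩ => ⟨f ≫ e.inv, inferInstance⟩
      left_inv := fun f => by simp
      right_inv := fun f => by simp }

/-- If `a` and `b` have equally many morphisms to `c`, and equally many epimorphisms onto each
proper subobject of `c`, then they have equally many epimorphisms onto `c`. -/
theorem HasEpiMonoFactorization.card_epi_eq {C : Type u} [Category.{v} C]
    (hF : HasEpiMonoFactorization C) (hfin : ∀ a b : C, Finite (a ⟶ b)) {a b c : C}
    (hc : Nat.card (a ⟶ c) = Nat.card (b ⟶ c))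
    (hS : ∀ S : Subobject c, S ≠ ⊤ →
      Nat.card { f : a ⟶ (S : C) // Epi f } = Nat.card { f : b ⟶ (S : C) // Epi f }) :
    Nat.card { f : a ⟶ c // Epi f } = Nat.card { f : b ⟶ c // Epi f } := by
  classical
  have hsum (x : C) : Nat.card { f : x ⟶ c // Epi f } + Nat.card { f : x ⟶ c // ¬ Epi f } =
      Nat.card (x ⟶ c) := by
    rw [← Nat.card_sum]
    exact Nat.card_congr (Equiv.sumCompl _)
  obtain ⟨ea⟩ := hF.nonempty_sigma_equiv a c
  obtain ⟨eb⟩ := hF.nonempty_sigma_equiv b c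
  have hne : Nat.card { f : a ⟶ c // ¬ Epi f } = Nat.card { f : b ⟶ c // ¬ Epi f } :=
    Nat.card_congr (ea.symm.trans ((Equiv.sigmaCongrRight fun S : { S : Subobject c // S ≠ ⊤ } =>
      (Finite.card_eq.1 (hS S.1 S.2)).some).trans eb))
  have := hsum a
  have := hsum b
  omega

theorem ConditionM.card_epi_eq_of_card_hom_eq {C : Type u} [Category.{v} C]
    (hM : ConditionM C) {a b : C} (h : ∀ c : C, Nat.card (a ⟶ c) = Nat.card (b ⟶ c)) (c : C) :
    Nat.card { f : a ⟶ c // Epi f } = Nat.card { f : b ⟶ c // Epi f } := by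
  obtain ⟨hfin, hF, hwf⟩ := hM
  have key (S : Subobject c) :
      Nat.card { f : a ⟶ (S : C) // Epi f } = Nat.card { f : b ⟶ (S : C) // Epi f } := by
    induction S using (hwf c).induction with
    | _ S ih =>
      refine hF.card_epi_eq hfin (h _) fun T hT => ?_
      let e := Subobject.underlyingIso (T.arrow ≫ S.arrow)
      rw [← card_epi_congr_right a e, ← card_epi_congr_right b e]
      refine ih _ ⟨⟨e.hom ≫ T.arrow, inferInstance⟩, ?_⟩
      rintro ⟨g, hg⟩
      have := isIso_of_mono_of_mono T.arrow (g ≫ e.hom)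
      exact hT (Subobject.eq_top_of_isIso_arrow T)
  let e := asIso (⊤ : Subobject c).arrow
  rw [← card_epi_congr_right a e, ← card_epi_congr_right b e]
  exact key ⊤

/-- Under condition 𝕄, for objects `a, b` the following are equivalent:
(i) `a ≅ b`; (ii) `|Hom(a,c)| = |Hom(b,c)|` for every `c`; (iii) `|Epi(a,c)| = |Epi(b,c)|`
for every `c`. -/
theorem iso_iff_homCount_eq_iff_epiCount_eq (C : Type u) [Category.{v} C]
    (hM : ConditionM C) (a b : C) :
    List.TFAE
      [Nonempty (a ≅ b),
       ∀ c : C, Nat.card (a ⟶ c) = Nat.card (b ⟶ c),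
       ∀ c : C, Nat.card { f : a ⟶ c // Epi f } = Nat.card { f : b ⟶ c // Epi f }] := by
  have hfin := hM.1
  tfae_have 1 → 2 := fun ⟨e⟩ c => Nat.card_congr (e.homCongr (Iso.refl c))
  tfae_have 2 → 3 := hM.card_epi_eq_of_card_hom_eq
  tfae_have 3 → 1 := fun h => by
    have : Nonempty { f : a ⟶ a // Epi f } := ⟨⟨𝟙 a, inferInstance⟩⟩
    have : Nonempty { f : b ⟶ b // Epi f } := ⟨⟨𝟙 b, inferInstance⟩⟩
    obtain ⟨⟨g, hg⟩⟩ := (Nat.card_pos_iff.1 (h a ▸ Nat.card_pos)).1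
    obtain ⟨⟨f, hf⟩⟩ := (Nat.card_pos_iff.1 ((h b).symm ▸ Nat.card_pos)).1
    exact nonempty_iso_of_epi_of_epi f g
  tfae_finish
end

section
/- Let C be a category satisfying condition 𝔼 and having finite products, and let a₁, …, aₙ be objects of C. Then the following are equivalent: (i) the objects a₁, …, aₙ are free in the product semigroup of C, i.e., for any two distinct n-tuples (k₁,…,kₙ) and (l₁,…,lₙ) of nonnegative integers, the products a₁^{×k₁} × ⋯ × aₙ^{×kₙ} and a₁^{×l₁} × ⋯ × aₙ^{×lₙ} are non-isomorphic; (ii) the functions h^{a₁}, …, h^{aₙ} are algebraically independent over ℤ, i.e., if P ∈ ℤ[X₁,…,Xₙ] is a polynomial such that P(h^{a₁}(c), …, h^{aₙ}(c)) = 0 for all objects c of C, then P is the zero polynomial. -/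
open CategoryTheory

universe v u

/-- Condition 𝔼: `C` is locally finite, morphisms admit epi-mono factorization, and for every
object `c` the poset of quotients of `c` (subobjects of `c` in the opposite category), ordered
by `d ≤ d'` iff there is an epimorphism `d' ⟶ d`, is well-founded (with respect to the
associated strict order). -/
def ConditionE (C : Type u) [Category.{v} C] : Prop :=
  (∀ a b : C, Finite (a ⟶ b)) ∧ HasEpiMonoFactorization C ∧
    ∀ c : C, WellFounded (fun S T : Subobject (Opposite.op c) =>
      (∃ f : (Subobject.underlying.obj T).unop ⟶ (Subobject.underlying.obj S).unop, Epi f) ∧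
        ¬ ∃ f : (Subobject.underlying.obj S).unop ⟶ (Subobject.underlying.obj T).unop, Epi f)

open CategoryTheory.Limits

/-- The `k`-fold product of an object with itself (the terminal object when `k = 0`). -/
noncomputable def prodPow {C : Type u} [Category.{v} C] [HasFiniteProducts C]
    (a : C) : ℕ → C
  | 0 => ⊤_ C
  | k + 1 => a ⨯ prodPow a k

section HomCount

variable {C : Type u} [Category.{v} C]

/-- An epimorphic endomorphism is invertible when the endomorphism monoid is finite. -/
theorem isIso_of_epi_of_finite {c : C} [Finite (c ⟶ c)] (f : c ⟶ c) [Epi f] : IsIso f := by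
  have hinj : Function.Injective (fun g : c ⟶ c => f ≫ g) := fun g h hgh =>
    (cancel_epi f).1 hgh
  obtain ⟨g, hg⟩ := (Finite.injective_iff_surjective.1 hinj) (𝟙 c)
  have : IsSplitMono f := IsSplitMono.mk' ⟨g, hg⟩
  exact isIso_of_epi_of_isSplitMono f

/-- A monomorphic endomorphism is invertible when the endomorphism monoid is finite. -/
theorem isIso_of_mono_of_finite {c : C} [Finite (c ⟶ c)] (f : c ⟶ c) [Mono f] : IsIso f := by
  have hinj : Function.Injective (fun g : c ⟶ c => g ≫ f) := fun g h hgh =>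
    (cancel_mono f).1 hgh
  obtain ⟨g, hg⟩ := (Finite.injective_iff_surjective.1 hinj) (𝟙 c)
  have : IsSplitEpi f := IsSplitEpi.mk' ⟨g, hg⟩
  exact isIso_of_mono_of_isSplitEpi f

theorem isIso_of_epi_of_epi_back {c d : C} [Finite (c ⟶ c)] (f : c ⟶ d) [Epi f]
    (g : d ⟶ c) [Epi g] : IsIso f := by
  have : IsIso (f ≫ g) := isIso_of_epi_of_finite _
  have : IsSplitMono f := IsSplitMono.mk' ⟨g ≫ inv (f ≫ g), by
    rw [← Category.assoc, IsIso.hom_inv_id]⟩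
  exact isIso_of_epi_of_isSplitMono f

theorem isIso_of_mono_of_mono_back {c d : C} [Finite (d ⟶ d)] (f : c ⟶ d) [Mono f]
    (g : d ⟶ c) [Mono g] : IsIso f := by
  have : IsIso (g ≫ f) := isIso_of_mono_of_finite _
  have : IsSplitEpi f := IsSplitEpi.mk' ⟨inv (g ≫ f) ≫ g, by
    rw [Category.assoc, IsIso.inv_hom_id]⟩
  exact isIso_of_mono_of_isSplitEpi f

/-- `d` is a quotient of `c`, but not conversely. -/
def StrictQuotient (d c : C) : Prop :=
  (∃ f : c ⟶ d, Epi f) ∧ ¬ ∃ f : d ⟶ c, Epi f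

theorem exists_epi_of_iso_left {c c' d : C} (e : c ≅ c') (h : ∃ f : c ⟶ d, Epi f) :
    ∃ f : c' ⟶ d, Epi f := by
  obtain ⟨f, hf⟩ := h
  exact ⟨e.inv ≫ f, epi_comp _ _⟩

theorem exists_epi_of_iso_right {c d d' : C} (e : d ≅ d') (h : ∃ f : c ⟶ d, Epi f) :
    ∃ f : c ⟶ d', Epi f := by
  obtain ⟨f, hf⟩ := h
  exact ⟨f ≫ e.hom, epi_comp _ _⟩

theorem StrictQuotient.of_iso {c c' d d' : C} (e : d ≅ d') (e' : c ≅ c')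
    (h : StrictQuotient d c) : StrictQuotient d' c' :=
  ⟨exists_epi_of_iso_left e' (exists_epi_of_iso_right e h.1), fun h' =>
    h.2 (exists_epi_of_iso_left e.symm (exists_epi_of_iso_right e'.symm h'))⟩

theorem acc_strictQuotient_of_iso {c c' : C} (e : c ≅ c')
    (h : Acc (StrictQuotient (C := C)) c) : Acc (StrictQuotient (C := C)) c' :=
  ⟨_, fun _ hd => h.inv (hd.of_iso (Iso.refl _) e.symm)⟩

/-- The object underlying a quotient of `c`. -/
noncomputable abbrev quotientObj {c : C} (T : Subobject (Opposite.op c)) : C :=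
  (Subobject.underlying.obj T).unop

/-- The projection of `c` onto one of its quotients. -/
noncomputable abbrev quotientMap {c : C} (T : Subobject (Opposite.op c)) : c ⟶ quotientObj T :=
  T.arrow.unop

noncomputable def quotientObjMkIso {c d : C} (p : c ⟶ d) [Epi p] :
    quotientObj (Subobject.mk p.op) ≅ d :=
  (Subobject.underlyingIso p.op).symm.unop

theorem quotientMap_mk_hom {c d : C} (p : c ⟶ d) [Epi p] :
    quotientMap (Subobject.mk p.op) ≫ (quotientObjMkIso p).hom = p :=
  Quiver.Hom.op_inj (Subobject.underlyingIso_arrow p.op)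

noncomputable def quotientObjTopIso (c : C) :
    quotientObj (⊤ : Subobject (Opposite.op c)) ≅ c :=
  (asIso (⊤ : Subobject (Opposite.op c)).arrow).symm.unop

theorem wellFounded_strictQuotient
    (hwf : ∀ c : C, WellFounded (fun S T : Subobject (Opposite.op c) =>
      StrictQuotient (quotientObj S) (quotientObj T))) :
    WellFounded (StrictQuotient (C := C)) := by
  refine ⟨fun c => acc_strictQuotient_of_iso (quotientObjTopIso c) ?_⟩
  induction (⊤ : Subobject (Opposite.op c)) using (hwf c).induction with
  | _ S ih =>
    refine ⟨_, fun d hd => ?_⟩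
    obtain ⟨f, hf⟩ := hd.1
    have : Epi (quotientMap S ≫ f) := epi_comp _ _
    have e := quotientObjMkIso (quotientMap S ≫ f)
    exact acc_strictQuotient_of_iso e (ih _ (hd.of_iso e.symm (Iso.refl _)))

theorem strictQuotient_of_ne_top {c : C} [Finite (c ⟶ c)] {T : Subobject (Opposite.op c)}
    (hT : T ≠ ⊤) : StrictQuotient (quotientObj T) c := by
  refine ⟨⟨quotientMap T, inferInstance⟩, fun ⟨g, hg⟩ => hT ?_⟩
  have : IsIso (quotientMap T) := isIso_of_epi_of_epi_back _ g
  exact (Subobject.isIso_arrow_iff_eq_top T).1 ((isIso_unop_iff T.arrow).1 this)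

/-- The number of monomorphisms from `c` to `a`. -/
noncomputable def monoCount (c a : C) : ℕ :=
  Nat.card {f : c ⟶ a // Mono f}

theorem monoCount_congr {c c' : C} (e : c ≅ c') (a : C) : monoCount c a = monoCount c' a :=
  Nat.card_congr <| e.homFromEquiv.subtypeEquiv fun f =>
    ⟨fun _ => mono_comp e.inv f, fun h => by
      have : Mono (e.inv ≫ f) := h
      simpa using mono_comp e.hom (e.inv ≫ f)⟩

/-- Every morphism out of `c` has a unique quotient of `c` as its coimage. -/
theorem HasEpiMonoFactorization.exists_coimage (hC : HasEpiMonoFactorization C) {c a : C}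
    (f : c ⟶ a) : ∃ S : Subobject (Opposite.op c), ∀ T : Subobject (Opposite.op c),
      S = T ↔ ∃ i : quotientObj T ⟶ a, Mono i ∧ quotientMap T ≫ i = f := by
  obtain ⟨m, p, i, hp, hi, rfl, huniq⟩ := hC f
  refine ⟨Subobject.mk p.op, fun T => ⟨?_, ?_⟩⟩
  · rintro rfl
    exact ⟨(quotientObjMkIso p).hom ≫ i, mono_comp _ _, by
      rw [← Category.assoc, quotientMap_mk_hom]⟩
  · rintro ⟨i', hi', h⟩
    obtain ⟨δ, hδ, -⟩ := huniq _ (quotientMap T) i' inferInstance hi' h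
    refine (Subobject.eq_mk_of_comm p.op δ.op ?_).symm
    exact Quiver.Hom.unop_inj hδ

open Classical in
/-- Morphisms out of `c` are counted by their coimages. -/
theorem HasEpiMonoFactorization.exists_card_hom_eq_sum (hC : HasEpiMonoFactorization C)
    (c a : C) [Finite (c ⟶ a)] : ∃ t : Finset (Subobject (Opposite.op c)),
      ∀ s, t ⊆ s → Nat.card (c ⟶ a) = ∑ T ∈ s, monoCount (quotientObj T) a := by
  choose q hq using fun f : c ⟶ a => hC.exists_coimage f
  have := Fintype.ofFinite (c ⟶ a)
  refine ⟨Finset.univ.image q, fun s hs => ?_⟩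
  rw [Nat.card_eq_fintype_card, ← Finset.card_univ, Finset.card_eq_sum_card_fiberwise
    (f := q) (t := s) fun f _ => hs (Finset.mem_image_of_mem q (Finset.mem_univ f))]
  refine Finset.sum_congr rfl fun T _ => ?_
  rw [← Fintype.card_subtype, ← Nat.card_eq_fintype_card]
  refine (Nat.card_congr (Equiv.ofBijective (fun i : {i : quotientObj T ⟶ a // Mono i} =>
    (⟨quotientMap T ≫ i.1, (hq _ T).2 ⟨i.1, i.2, rfl⟩⟩ : {f : c ⟶ a // q f = T})) ⟨?_, ?_⟩)).symm
  · intro i j hij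
    exact Subtype.ext ((cancel_epi (quotientMap T)).1 (congrArg Subtype.val hij))
  · rintro ⟨f, hf⟩
    obtain ⟨i, hi, rfl⟩ := (hq f T).1 hf
    exact ⟨⟨i, hi⟩, rfl⟩

/-- A linear relation between the functions `h^{A i}` also holds for counts of monomorphisms. -/
theorem ConditionE.sum_monoCount_eq_zero (hE : ConditionE C) {ι : Type*} (s : Finset ι)
    (A : ι → C) (w : ι → ℤ) (h : ∀ c, ∑ i ∈ s, w i * (Nat.card (c ⟶ A i) : ℤ) = 0) (c : C) :
    ∑ i ∈ s, w i * (monoCount c (A i) : ℤ) = 0 := by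
  classical
  obtain ⟨hfin, hfac, hwf⟩ := hE
  induction c using (wellFounded_strictQuotient hwf).induction with
  | _ c ih =>
    choose t ht using fun i => hfac.exists_card_hom_eq_sum c (A i)
    have hsum := h c
    have hcard : ∀ i ∈ s, w i * (Nat.card (c ⟶ A i) : ℤ) =
        ∑ T ∈ insert ⊤ (s.biUnion t), w i * (monoCount (quotientObj T) (A i) : ℤ) := by
      intro i hi
      rw [ht i _ ((Finset.subset_biUnion_of_mem t hi).trans (Finset.subset_insert _ _)),
        Nat.cast_sum, Finset.mul_sum]
    rw [Finset.sum_congr rfl hcard, Finset.sum_comm,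
      Finset.sum_eq_single_of_mem ⊤ (Finset.mem_insert_self _ _)
        fun T _ hT => ih _ (strictQuotient_of_ne_top hT)] at hsum
    simpa only [monoCount_congr (quotientObjTopIso c)] using hsum

/-- The functions `h^{A i}` of pairwise non-isomorphic objects are linearly independent. -/
theorem ConditionE.eq_zero_of_sum_card_hom_eq_zero (hE : ConditionE C) {ι : Type*}
    (s : Finset ι) (A : ι → C) (hA : ∀ i j, i ≠ j → ¬ Nonempty (A i ≅ A j)) (w : ι → ℤ)
    (h : ∀ c, ∑ i ∈ s, w i * (Nat.card (c ⟶ A i) : ℤ) = 0) : ∀ i ∈ s, w i = 0 := by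
  classical
  have hfin := hE.1
  by_contra! hne
  obtain ⟨i₀, hi₀, hw₀⟩ := hne
  let _ : Preorder ι :=
    { le := fun i j => ∃ f : A i ⟶ A j, Mono f
      le_refl := fun i => ⟨𝟙 _, inferInstance⟩
      le_trans := fun _ _ _ ⟨f, _⟩ ⟨g, _⟩ => ⟨f ≫ g, mono_comp f g⟩ }
  obtain ⟨k, hk⟩ := (s.filter (w · ≠ 0)).exists_maximal ⟨i₀, by simp [hi₀, hw₀]⟩
  obtain ⟨hks, hwk⟩ := Finset.mem_filter.1 hk.prop
  have hsum := hE.sum_monoCount_eq_zero s A w h (A k)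
  rw [Finset.sum_eq_single_of_mem k hks] at hsum
  · have hpos : 0 < monoCount (A k) (A k) :=
      have : Nonempty {f : A k ⟶ A k // Mono f} := ⟨⟨𝟙 _, inferInstance⟩⟩
      Nat.card_pos
    rcases mul_eq_zero.1 hsum with h0 | h0
    · exact hwk h0
    · exact hpos.ne' (by exact_mod_cast h0)
  · intro j hj hjk
    by_cases hwj : w j = 0
    · rw [hwj, zero_mul]
    have : IsEmpty {f : A k ⟶ A j // Mono f} := by
      refine ⟨fun ⟨f, hf⟩ => ?_⟩
      obtain ⟨g, hg⟩ := hk.le_of_ge (Finset.mem_filter.2 ⟨hj, hwj⟩) ⟨f, hf⟩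
      have : IsIso f := isIso_of_mono_of_mono_back f g
      exact hA k j hjk.symm ⟨asIso f⟩
    rw [monoCount, Nat.card_of_isEmpty, Nat.cast_zero, mul_zero]

theorem card_hom_prodPow [HasFiniteProducts C] (c a : C) (k : ℕ) :
    Nat.card (c ⟶ prodPow a k) = Nat.card (c ⟶ a) ^ k := by
  induction k with
  | zero =>
    rw [pow_zero, prodPow]
    exact Nat.card_unique
  | succ k ih =>
    rw [pow_succ', ← ih, ← Nat.card_prod]
    exact Nat.card_congr
      { toFun := fun f => (f ≫ prod.fst, f ≫ prod.snd)
        invFun := fun f => prod.lift f.1 f.2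
        left_inv := fun f => prod.hom_ext (prod.lift_fst _ _) (prod.lift_snd _ _)
        right_inv := fun f => Prod.ext (prod.lift_fst _ _) (prod.lift_snd _ _) }

theorem card_hom_piObj [HasFiniteProducts C] {n : ℕ} (c : C) (b : Fin n → C) :
    Nat.card (c ⟶ ∏ᶜ b) = ∏ i, Nat.card (c ⟶ b i) := by
  rw [← Nat.card_pi]
  exact Nat.card_congr
    { toFun := fun f i => f ≫ Pi.π b i
      invFun := fun f => Pi.lift f
      left_inv := fun f => Pi.hom_ext _ _ (by simp)
      right_inv := fun f => by ext; simp }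

theorem card_hom_prod_prodPow [HasFiniteProducts C] {n : ℕ} (c : C) (a : Fin n → C)
    (k : Fin n → ℕ) : Nat.card (c ⟶ ∏ᶜ fun i => prodPow (a i) (k i)) =
      ∏ i, Nat.card (c ⟶ a i) ^ k i := by
  simp only [card_hom_piObj, card_hom_prodPow]

end HomCount

/-- Under condition 𝔼, in a category with finite products, objects
`a 0, …, a (n-1)` are free in the product semigroup (distinct tuples of multiplicities give
non-isomorphic products) iff the functions `h^{a i}(c) = |Hom(c, a i)|` are algebraically
independent over `ℤ`. -/
theorem free_in_prod_semigroup_iff_homCount_algIndep (C : Type u) [Category.{v} C]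
    [HasFiniteProducts C] (hE : ConditionE C) (n : ℕ) (a : Fin n → C) :
    (∀ k l : Fin n → ℕ, k ≠ l →
        ¬ Nonempty ((∏ᶜ fun i => prodPow (a i) (k i)) ≅ ∏ᶜ fun i => prodPow (a i) (l i))) ↔
      ∀ P : MvPolynomial (Fin n) ℤ,
        (∀ c : C, MvPolynomial.eval (fun i => (Nat.card (c ⟶ a i) : ℤ)) P = 0) → P = 0 := by
  constructor
  · intro hfree P hP
    have hzero := hE.eq_zero_of_sum_card_hom_eq_zero P.support
      (fun k => ∏ᶜ fun i => prodPow (a i) (k i))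
      (fun k l hkl => hfree k l (DFunLike.coe_injective.ne hkl)) (fun k => P.coeff k) (by
        intro c
        rw [← hP c, MvPolynomial.eval_eq']
        simp only [card_hom_prod_prodPow, Nat.cast_prod, Nat.cast_pow])
    ext k
    rw [MvPolynomial.coeff_zero]
    by_contra hk
    exact hk (hzero k (MvPolynomial.mem_support_iff.2 hk))
  · rintro hindep k l hkl ⟨e⟩
    have hPQ := hindep (MvPolynomial.monomial (Finsupp.equivFunOnFinite.symm k) 1 -
      MvPolynomial.monomial (Finsupp.equivFunOnFinite.symm l) 1) (by
        intro c
        have hcard := Nat.card_congr (Iso.homCongr (Iso.refl c) e)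
        rw [card_hom_prod_prodPow, card_hom_prod_prodPow] at hcard
        rw [map_sub, MvPolynomial.eval_monomial, MvPolynomial.eval_monomial, sub_eq_zero]
        simp only [Finsupp.prod_fintype _ _ fun _ => pow_zero _, one_mul,
          Finsupp.equivFunOnFinite_symm_apply_apply]
        exact_mod_cast hcard)
    exact hkl (Finsupp.equivFunOnFinite.symm.injective
      (MvPolynomial.monomial_left_injective one_ne_zero (sub_eq_zero.1 hPQ)))
end
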